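/- arXiv:hep-th/0312277 — 2 statements merged into one kernel-verified Lean document; each statement's English description precedes it below -/
import Mathlib

section
/- Let δ > 0 and let f be an analytic function on the strip {θ ∈ ℂ : |Im θ| < δ} such that |f(θ)| = O(1/(Re θ)²) as |Re θ| → ∞, uniformly in the strip. Then there exists an analytic function ν on the strip {θ ∈ ℂ : |Im θ| < π/2 + δ} such that ν(θ) = (1/2π)∫_ℝ tanh(θ′ − θ) f(θ′) dθ′ for all real θ, and for every θ with |Im θ| < δ one has ν(θ + iπ/2) − ν(θ − iπ/2) = −i f(θ). -/
open Complex MeasureTheory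

section Helpers

open Filter Topology Set

lemma sinh_eq_re_im (w : ℂ) : sinh w =
    ↑(Real.sinh w.re * Real.cos w.im) + ↑(Real.cosh w.re * Real.sin w.im) * I := by
  conv_lhs => rw [← re_add_im w, sinh_add, sinh_mul_I, cosh_mul_I]
  push_cast
  ring

lemma cosh_eq_re_im (w : ℂ) : cosh w =
    ↑(Real.cosh w.re * Real.cos w.im) + ↑(Real.sinh w.re * Real.sin w.im) * I := by
  conv_lhs => rw [← re_add_im w, cosh_add, sinh_mul_I, cosh_mul_I]
  push_cast
  ring

lemma norm_sinh_sq (w : ℂ) : ‖sinh w‖ ^ 2 = Real.sinh w.re ^ 2 + Real.sin w.im ^ 2 := by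
  rw [sinh_eq_re_im, ← normSq_eq_norm_sq, normSq_add_mul_I]
  linear_combination Real.sin w.im ^ 2 * Real.cosh_sq w.re
    + Real.sinh w.re ^ 2 * Real.sin_sq_add_cos_sq w.im

lemma norm_cosh_sq (w : ℂ) : ‖cosh w‖ ^ 2 = Real.sinh w.re ^ 2 + Real.cos w.im ^ 2 := by
  rw [cosh_eq_re_im, ← normSq_eq_norm_sq, normSq_add_mul_I]
  linear_combination Real.cos w.im ^ 2 * Real.cosh_sq w.re
    + Real.sinh w.re ^ 2 * Real.sin_sq_add_cos_sq w.im

lemma abs_cos_im_le_norm_cosh (w : ℂ) : |Real.cos w.im| ≤ ‖cosh w‖ := by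
  rw [← abs_norm (cosh w), ← sq_le_sq, norm_cosh_sq]
  nlinarith [sq_nonneg (Real.sinh w.re)]

lemma abs_cos_im_mul_norm_sinh_le (w : ℂ) : |Real.cos w.im| * ‖sinh w‖ ≤ ‖cosh w‖ := by
  refine le_of_sq_le_sq ?_ (norm_nonneg _)
  rw [mul_pow, norm_cosh_sq, norm_sinh_sq, sq_abs]
  nlinarith [sq_nonneg (Real.sinh w.re), Real.sin_sq_add_cos_sq w.im, sq_nonneg (Real.cos w.im),
    sq_nonneg (Real.sin w.im), mul_nonneg (sq_nonneg (Real.sinh w.re)) (sq_nonneg (Real.sin w.im)),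
    mul_nonneg (sq_nonneg (Real.cos w.im)) (sq_nonneg (Real.cos w.im))]

lemma cosh_ne_zero_of_abs_im_lt {w : ℂ} (hw : |w.im| < Real.pi / 2) : cosh w ≠ 0 := by
  have := Real.cos_pos_of_mem_Ioo (abs_lt.1 hw)
  exact norm_pos_iff.1 ((abs_pos.2 this.ne').trans_le (abs_cos_im_le_norm_cosh w))

lemma sinh_ne_zero_of_abs_im_lt {w : ℂ} (hw : |w.im| < Real.pi) (h0 : w ≠ 0) : sinh w ≠ 0 := by
  intro h
  have hs := norm_sinh_sq w
  rw [h, norm_zero] at hs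
  have h1 : Real.sinh w.re = 0 := by
    nlinarith [sq_nonneg (Real.sinh w.re), sq_nonneg (Real.sin w.im)]
  have h2 : Real.sin w.im = 0 := by
    nlinarith [sq_nonneg (Real.sinh w.re), sq_nonneg (Real.sin w.im)]
  rw [Real.sinh_eq_zero] at h1
  rw [Real.sin_eq_zero_iff_of_lt_of_lt (abs_lt.1 hw).1 (abs_lt.1 hw).2] at h2
  exact h0 (Complex.ext h1 h2)

lemma norm_tanh_le {w : ℂ} {β : ℝ} (hβ : β < Real.pi / 2) (hw : |w.im| ≤ β) :
    ‖tanh w‖ ≤ (Real.cos β)⁻¹ := by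
  have hcβ : 0 < Real.cos β :=
    Real.cos_pos_of_mem_Ioo ⟨by linarith [abs_nonneg w.im, Real.pi_pos], hβ⟩
  have hle : Real.cos β ≤ |Real.cos w.im| := by
    rw [← Real.cos_abs w.im]
    exact (Real.cos_le_cos_of_nonneg_of_le_pi (abs_nonneg _) (by linarith [Real.pi_pos])
      hw).trans (le_abs_self _)
  have hc := norm_pos_iff.2 (cosh_ne_zero_of_abs_im_lt (hw.trans_lt hβ))
  rw [tanh_eq_sinh_div_cosh, norm_div, div_le_iff₀ hc, inv_mul_eq_div, le_div_iff₀ hcβ]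
  nlinarith [abs_cos_im_mul_norm_sinh_le w, norm_nonneg (sinh w)]

lemma norm_inv_cosh_sq_le {w : ℂ} {β : ℝ} (hβ : β < Real.pi / 2) (hw : |w.im| ≤ β) :
    ‖1 / cosh w ^ 2‖ ≤ (Real.cos β ^ 2)⁻¹ := by
  have hcβ : 0 < Real.cos β :=
    Real.cos_pos_of_mem_Ioo ⟨by linarith [abs_nonneg w.im, Real.pi_pos], hβ⟩
  have hle : Real.cos β ≤ |Real.cos w.im| := by
    rw [← Real.cos_abs w.im]
    exact (Real.cos_le_cos_of_nonneg_of_le_pi (abs_nonneg _) (by linarith [Real.pi_pos])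
      hw).trans (le_abs_self _)
  rw [one_div, norm_inv, norm_pow]
  gcongr
  exact hle.trans (abs_cos_im_le_norm_cosh w)

lemma hasDerivAt_tanh_of_cosh_ne_zero {w : ℂ} (hw : cosh w ≠ 0) :
    HasDerivAt tanh (1 / cosh w ^ 2) w := by
  have h := (hasDerivAt_sinh w).div (hasDerivAt_cosh w) hw
  have e : (sinh / cosh : ℂ → ℂ) = tanh := by
    ext z
    simp [tanh_eq_sinh_div_cosh]
  rw [e] at h
  refine h.congr_deriv ?_
  rw [← pow_two, ← pow_two, cosh_sq_sub_sinh_sq]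

lemma norm_cosh_div_sinh_le {w : ℂ} (hw : 1 ≤ |w.re|) : ‖cosh w / sinh w‖ ≤ 2 := by
  have h1 : 1 ≤ Real.sinh w.re ^ 2 := by
    rw [one_le_sq_iff_one_le_abs, Real.abs_sinh]
    exact hw.trans (Real.self_le_sinh_iff.2 (abs_nonneg _))
  have hs := norm_sinh_sq w
  have hc := norm_cosh_sq w
  have hpos : 0 < ‖sinh w‖ := by
    refine (norm_nonneg _).lt_of_ne fun h => ?_
    rw [← h] at hs
    nlinarith [sq_nonneg (Real.sin w.im)]
  rw [norm_div, div_le_iff₀ hpos]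
  refine le_of_sq_le_sq ?_ (by positivity)
  rw [mul_pow, hs, hc]
  nlinarith [sq_nonneg (Real.sin w.im), Real.sin_sq_add_cos_sq w.im]

lemma tanh_sub_pi_div_two_mul_I (w : ℂ) :
    tanh (w - (Real.pi / 2 : ℝ) * I) = cosh w / sinh w := by
  rw [tanh_eq_sinh_div_cosh, sinh_sub, cosh_sub, sinh_mul_I, cosh_mul_I, ← ofReal_cos,
    ← ofReal_sin, Real.cos_pi_div_two, Real.sin_pi_div_two]
  simp only [ofReal_zero, mul_zero, ofReal_one, one_mul, zero_sub]
  rw [neg_div_neg_eq, mul_div_mul_right _ _ I_ne_zero]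

lemma tanh_add_pi_div_two_mul_I (w : ℂ) :
    tanh (w + (Real.pi / 2 : ℝ) * I) = cosh w / sinh w := by
  rw [tanh_eq_sinh_div_cosh, sinh_add, cosh_add, sinh_mul_I, cosh_mul_I, ← ofReal_cos,
    ← ofReal_sin, Real.cos_pi_div_two, Real.sin_pi_div_two]
  simp only [ofReal_zero, mul_zero, ofReal_one, one_mul, zero_add]
  rw [mul_div_mul_right _ _ I_ne_zero]

/-- The two ends of the horizontal strip of points with imaginary part in `s`. -/
def stripEnds (s : Set ℝ) : Filter ℂ := comap (fun z => |z.re|) atTop ⊓ 𝓟 (im ⁻¹' s)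

lemma tendsto_abs_re_stripEnds (s : Set ℝ) :
    Tendsto (fun z : ℂ => |z.re|) (stripEnds s) atTop :=
  tendsto_comap.mono_left inf_le_left

lemma eventually_im_mem_stripEnds (s : Set ℝ) : ∀ᶠ z in stripEnds s, z.im ∈ s :=
  mem_inf_of_right (mem_principal_self _)

lemma tendsto_integral_sub_of_tendsto_stripEnds {G : ℂ → ℂ} {a b : ℝ}
    (hG : DifferentiableOn ℂ G (im ⁻¹' (uIcc a b)))
    (h0 : Tendsto G (stripEnds (uIcc a b)) (𝓝 0)) :
    Tendsto (fun T : ℝ => ∫ t in (-T)..T, (G (t + a * I) - G (t + b * I))) atTop (𝓝 0) := by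
  have hcont : ∀ c ∈ uIcc a b, Continuous fun t : ℝ => G (t + c * I) := fun c hc =>
    hG.continuousOn.comp_continuous (by fun_prop) fun t => by simpa using hc
  rw [Metric.tendsto_atTop]
  intro ε hε
  have hev : ∀ᶠ z in stripEnds (uIcc a b), ‖G z‖ < ε / (2 * (|b - a| + 1)) := by
    simpa using h0.norm.eventually_lt_const (u := ε / (2 * (|b - a| + 1)))
      (by rw [norm_zero]; positivity)
  rw [stripEnds, eventually_inf_principal, eventually_comap] at hev
  obtain ⟨R, hR⟩ := eventually_atTop.1 hev
  refine ⟨R, fun T hT => ?_⟩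
  have hside : ∀ x : ℝ, R ≤ |x| →
      ‖∫ y in a..b, G (x + y * I)‖ ≤ ε / (2 * (|b - a| + 1)) * |b - a| := fun x hx =>
    intervalIntegral.norm_integral_le_of_norm_le_const fun y hy =>
      (hR _ hx _ (by simp) (by simpa using uIoc_subset_uIcc hy)).le
  have hrect := integral_boundary_rect_eq_zero_of_differentiableOn G (-T + a * I) (T + b * I)
    (hG.mono fun z hz => by simpa using (mem_reProdIm.1 hz).2)
  simp only [add_re, add_im, neg_re, neg_im, ofReal_re, ofReal_im, mul_re, mul_im, I_re, I_im,
    mul_zero, mul_one, sub_zero, add_zero, zero_add, neg_zero, smul_eq_mul, ofReal_neg] at hrect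
  rw [dist_zero_right, intervalIntegral.integral_sub
    ((hcont a left_mem_uIcc).intervalIntegrable _ _)
    ((hcont b right_mem_uIcc).intervalIntegrable _ _)]
  have h1 := hside T (hT.trans (le_abs_self T))
  have h2 := hside (-T) ((hT.trans (le_abs_self T)).trans_eq (abs_neg T).symm)
  push_cast at h2
  have heq : (∫ t in (-T)..T, G (t + a * I)) - ∫ t in (-T)..T, G (t + b * I) =
      I * (∫ y in a..b, G (-T + y * I)) - I * ∫ y in a..b, G (T + y * I) := by
    linear_combination hrect
  rw [heq]
  refine (norm_sub_le _ _).trans_lt ?_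
  rw [norm_mul, norm_mul, norm_I, one_mul, one_mul]
  refine (add_le_add h2 h1).trans_lt ?_
  have : 0 < |b - a| + 1 := by positivity
  rw [← mul_add, div_mul_eq_mul_div, div_lt_iff₀ (by positivity)]
  nlinarith

lemma integral_sub_eq_zero_of_tendsto_stripEnds {G : ℂ → ℂ} {a b : ℝ}
    (hG : DifferentiableOn ℂ G (im ⁻¹' (uIcc a b)))
    (h0 : Tendsto G (stripEnds (uIcc a b)) (𝓝 0))
    (hint : Integrable fun t : ℝ => G (t + a * I) - G (t + b * I)) :
    ∫ t : ℝ, (G (t + a * I) - G (t + b * I)) = 0 :=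
  tendsto_nhds_unique
    (intervalIntegral_tendsto_integral hint tendsto_neg_atTop_atBot tendsto_id)
    (tendsto_integral_sub_of_tendsto_stripEnds hG h0)

lemma abs_sub_lt_of_mem_uIcc {a b c x r : ℝ} (ha : |a - x| < r) (hb : |b - x| < r)
    (hc : c ∈ uIcc a b) : |c - x| < r := by
  rw [← Real.dist_eq] at *
  rw [← Metric.mem_ball, Real.ball_eq_Ioo] at *
  exact ordConnected_Ioo.uIcc_subset ha hb hc

section ShiftedKernel

variable {δ : ℝ} {f : ℂ → ℂ}

lemma continuous_horizontal (hf : DifferentiableOn ℂ f {θ : ℂ | |θ.im| < δ}) {c : ℝ}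
    (hc : |c| < δ) : Continuous fun t : ℝ => f (t + c * I) :=
  hf.continuousOn.comp_continuous (by fun_prop) fun t => by simpa using hc

lemma integrable_horizontal (hf : DifferentiableOn ℂ f {θ : ℂ | |θ.im| < δ})
    {C R : ℝ} (hO : ∀ θ : ℂ, |θ.im| < δ → R ≤ |θ.re| → ‖f θ‖ ≤ C / θ.re ^ 2)
    {c : ℝ} (hc : |c| < δ) : Integrable fun t : ℝ => f (t + c * I) := by
  refine (continuous_horizontal hf hc).locallyIntegrable.integrable_of_isBigO_cocompact
    (Asymptotics.IsBigO.of_bound (2 * |C|) ?_)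
    (integrable_inv_one_add_sq.integrableAtFilter _)
  filter_upwards [(tendsto_norm_cocompact_atTop (E := ℝ)).eventually_ge_atTop (max R 1)] with t ht
  rw [Real.norm_eq_abs, max_le_iff] at ht
  have h1 := hO (t + c * I) (by simpa using hc) (by simpa using ht.1)
  have ht2 : 1 ≤ t ^ 2 := (one_le_sq_iff_one_le_abs t).2 ht.2
  simp only [add_re, ofReal_re, mul_re, I_re, mul_zero, ofReal_im, I_im, mul_one, sub_self,
    add_zero] at h1
  refine h1.trans ?_
  rw [Real.norm_of_nonneg (by positivity), ← div_eq_mul_inv,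
    div_le_div_iff₀ (by positivity) (by positivity)]
  nlinarith [le_abs_self C, abs_nonneg C, mul_nonneg (abs_nonneg C) (sub_nonneg.2 ht2)]

lemma tendsto_stripEnds_zero {s : Set ℝ} (hs : ∀ c ∈ s, |c| < δ)
    {C R : ℝ} (hO : ∀ θ : ℂ, |θ.im| < δ → R ≤ |θ.re| → ‖f θ‖ ≤ C / θ.re ^ 2) :
    Tendsto f (stripEnds s) (𝓝 0) := by
  have hlim : Tendsto (fun z : ℂ => C / |z.re| ^ 2) (stripEnds s) (𝓝 0) :=
    ((tendsto_pow_atTop two_ne_zero).comp (tendsto_abs_re_stripEnds s)).const_div_atTop C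
  refine squeeze_zero_norm' ?_ hlim
  filter_upwards [eventually_im_mem_stripEnds s,
    (tendsto_abs_re_stripEnds s).eventually_ge_atTop R] with z hz hR
  rw [sq_abs]
  exact hO z (hs _ hz) hR

lemma tendsto_mul_stripEnds_zero {s : Set ℝ} (hs : ∀ c ∈ s, |c| < δ)
    {C R : ℝ} (hO : ∀ θ : ℂ, |θ.im| < δ → R ≤ |θ.re| → ‖f θ‖ ≤ C / θ.re ^ 2)
    {g : ℂ → ℂ} {B : ℝ} (hg : ∀ᶠ z in stripEnds s, ‖g z‖ ≤ B) :
    Tendsto (fun z => g z * f z) (stripEnds s) (𝓝 0) :=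
  squeeze_zero_norm' (hg.mono fun z hz => (norm_mul_le _ _).trans
      (mul_le_mul_of_nonneg_right hz (norm_nonneg _)))
    (by simpa using (tendsto_stripEnds_zero hs hO).norm.const_mul B)

/-- The integral of `tanh (z - θ) * f z` over the line `Im z = c`, divided by `2π`. -/
noncomputable def tanhIntegral (f : ℂ → ℂ) (c : ℝ) (θ : ℂ) : ℂ :=
  (1 / (2 * (Real.pi : ℂ))) * ∫ t : ℝ, tanh ((t + c * I : ℂ) - θ) * f (t + c * I)

lemma continuous_tanh_horizontal {c : ℝ} {θ : ℂ} (h : |c - θ.im| < Real.pi / 2) :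
    Continuous fun t : ℝ => tanh ((t + c * I : ℂ) - θ) :=
  continuous_iff_continuousAt.2 fun t =>
    ContinuousAt.comp (f := fun t : ℝ => (t + c * I : ℂ) - θ)
      (hasDerivAt_tanh_of_cosh_ne_zero
        (cosh_ne_zero_of_abs_im_lt (by simpa using h))).continuousAt (by fun_prop)

lemma integrable_tanh_mul (hf : DifferentiableOn ℂ f {θ : ℂ | |θ.im| < δ})
    {C R : ℝ} (hO : ∀ θ : ℂ, |θ.im| < δ → R ≤ |θ.re| → ‖f θ‖ ≤ C / θ.re ^ 2)
    {c : ℝ} (hc : |c| < δ) {θ : ℂ} (h : |c - θ.im| < Real.pi / 2) :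
    Integrable fun t : ℝ => tanh ((t + c * I : ℂ) - θ) * f (t + c * I) :=
  (integrable_horizontal hf hO hc).bdd_mul (continuous_tanh_horizontal h).aestronglyMeasurable
    (.of_forall fun t => norm_tanh_le h (by simp))

lemma differentiableAt_tanhIntegral (hf : DifferentiableOn ℂ f {θ : ℂ | |θ.im| < δ})
    {C R : ℝ} (hO : ∀ θ : ℂ, |θ.im| < δ → R ≤ |θ.re| → ‖f θ‖ ≤ C / θ.re ^ 2)
    {c : ℝ} (hc : |c| < δ) {θ : ℂ} (h : |c - θ.im| < Real.pi / 2) :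
    DifferentiableAt ℂ (tanhIntegral f c) θ := by
  obtain ⟨β, hθβ, hβ⟩ := exists_between h
  have hopen : IsOpen {w : ℂ | |c - w.im| < β} := isOpen_lt (by fun_prop) continuous_const
  have hnhds := hopen.mem_nhds hθβ
  have hlt : ∀ w ∈ {w : ℂ | |c - w.im| < β}, |c - w.im| < Real.pi / 2 := fun w hw => hw.trans hβ
  have hcosh : Continuous fun t : ℝ => cosh ((t + c * I : ℂ) - θ) := by fun_prop
  have hcosh0 : ∀ w : ℂ, |c - w.im| < Real.pi / 2 → ∀ t : ℝ, cosh ((t + c * I : ℂ) - w) ≠ 0 :=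
    fun w hw t => cosh_ne_zero_of_abs_im_lt (by simpa using hw)
  refine DifferentiableAt.const_mul (HasDerivAt.differentiableAt
    (hasDerivAt_integral_of_dominated_loc_of_deriv_le (μ := volume)
      (F := fun (w : ℂ) (t : ℝ) => tanh ((t + c * I : ℂ) - w) * f (t + c * I))
      (F' := fun (w : ℂ) (t : ℝ) => -(1 / cosh ((t + c * I : ℂ) - w) ^ 2) * f (t + c * I))
      (bound := fun t : ℝ => (Real.cos β ^ 2)⁻¹ * ‖f (t + c * I)‖)
      hnhds ?_ (integrable_tanh_mul hf hO hc h) ?_ ?_ ?_ ?_).2) _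
  · filter_upwards [hnhds] with w hw
    exact (integrable_tanh_mul hf hO hc (hlt w hw)).aestronglyMeasurable
  · exact ((continuous_const.div (hcosh.pow 2) fun t => pow_ne_zero 2 (hcosh0 θ h t)).neg.mul
      (continuous_horizontal hf hc)).aestronglyMeasurable
  · refine .of_forall fun t w hw => ?_
    rw [norm_mul, norm_neg]
    gcongr
    exact norm_inv_cosh_sq_le hβ (by simpa using (show |c - w.im| < β from hw).le)
  · exact (integrable_horizontal hf hO hc).norm.const_mul _
  · refine .of_forall fun t w hw => ?_
    refine HasDerivAt.mul_const ?_ _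
    have := (hasDerivAt_tanh_of_cosh_ne_zero (hcosh0 w (hlt w hw) t)).comp w
      ((hasDerivAt_id w).const_sub (t + c * I : ℂ))
    simpa [Function.comp_def] using this

lemma tanhIntegral_eq_of_abs_lt (hf : DifferentiableOn ℂ f {θ : ℂ | |θ.im| < δ})
    {C R : ℝ} (hO : ∀ θ : ℂ, |θ.im| < δ → R ≤ |θ.re| → ‖f θ‖ ≤ C / θ.re ^ 2)
    {a b : ℝ} (ha : |a| < δ) (hb : |b| < δ) {θ : ℂ} (haθ : |a - θ.im| < Real.pi / 2)
    (hbθ : |b - θ.im| < Real.pi / 2) : tanhIntegral f a θ = tanhIntegral f b θ := by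
  have hs : ∀ c ∈ uIcc a b, |c| < δ := fun c hc => by
    simpa using abs_sub_lt_of_mem_uIcc (x := 0) (by simpa using ha) (by simpa using hb) hc
  obtain ⟨β, hβ', hβ⟩ := exists_between (max_lt haθ hbθ)
  have hsθ : ∀ c ∈ uIcc a b, |c - θ.im| < β := fun c hc =>
    abs_sub_lt_of_mem_uIcc ((le_max_left _ _).trans_lt hβ') ((le_max_right _ _).trans_lt hβ') hc
  have hia := integrable_tanh_mul hf hO ha haθ
  have hib := integrable_tanh_mul hf hO hb hbθ
  have key := integral_sub_eq_zero_of_tendsto_stripEnds (G := fun z => tanh (z - θ) * f z)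
    (a := a) (b := b) ?_ ?_ (hia.sub hib)
  · rw [integral_sub hia hib, sub_eq_zero] at key
    rw [tanhIntegral, tanhIntegral, key]
  · refine DifferentiableOn.mul (fun z hz => ?_) (hf.mono fun z hz => hs _ hz)
    exact ((hasDerivAt_tanh_of_cosh_ne_zero (cosh_ne_zero_of_abs_im_lt
      (by simpa using (hsθ _ hz).trans hβ))).differentiableAt.comp z
        (by fun_prop)).differentiableWithinAt
  · refine tendsto_mul_stripEnds_zero hs hO (B := (Real.cos β)⁻¹) ?_
    filter_upwards [eventually_im_mem_stripEnds (uIcc a b)] with z hz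
    exact norm_tanh_le hβ (by simpa using (hsθ _ hz).le)


lemma inv_sub_inv_eq_cauchyPDFReal (θ : ℂ) {ε : ℝ} (hε : 0 < ε) (t : ℝ) :
    ((t + (θ.im + ε : ℝ) * I - θ : ℂ))⁻¹ - (t + (θ.im - ε : ℝ) * I - θ : ℂ)⁻¹ =
      -2 * Real.pi * I * (ProbabilityTheory.cauchyPDFReal θ.re ε.toNNReal t : ℝ) := by
  have h1 : (t + (θ.im + ε : ℝ) * I - θ : ℂ) = (t - θ.re : ℝ) + ε * I := by
    apply Complex.ext <;> simp
  have h2 : (t + (θ.im - ε : ℝ) * I - θ : ℂ) = (t - θ.re : ℝ) - ε * I := by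
    apply Complex.ext <;> simp
  have h3 : ((t - θ.re : ℝ) + ε * I : ℂ) ≠ 0 := fun h => hε.ne' (by simpa using congrArg im h)
  have h4 : ((t - θ.re : ℝ) - ε * I : ℂ) ≠ 0 := fun h => hε.ne' (by simpa using congrArg im h)
  have h5 : (((t - θ.re : ℝ) : ℂ) ^ 2 + (ε : ℂ) ^ 2) =
      ((t - θ.re : ℝ) + ε * I) * ((t - θ.re : ℝ) - ε * I) := by
    linear_combination (ε : ℂ) ^ 2 * I_sq
  have hpi : (Real.pi : ℂ) ≠ 0 := ofReal_ne_zero.2 Real.pi_ne_zero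
  rw [h1, h2, ProbabilityTheory.cauchyPDFReal_def, Real.coe_toNNReal _ hε.le, ofReal_mul,
    ofReal_mul, ofReal_inv, ofReal_inv, ofReal_add, ofReal_pow, ofReal_pow, h5]
  field_simp
  ring

lemma differentiable_dslope_sinh : Differentiable ℂ (dslope sinh 0) :=
  differentiableOn_univ.1 <|
    (differentiableOn_dslope univ_mem).2 differentiable_sinh.differentiableOn

lemma mul_dslope_sinh (w : ℂ) : w * dslope sinh 0 w = sinh w := by
  simpa using sub_smul_dslope sinh 0 w

lemma dslope_sinh_ne_zero {w : ℂ} (hw : |w.im| < Real.pi) : dslope sinh 0 w ≠ 0 := by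
  rcases eq_or_ne w 0 with rfl | h0
  · simp
  · intro h
    apply sinh_ne_zero_of_abs_im_lt hw h0
    rw [← mul_dslope_sinh, h, mul_zero]

lemma integral_coth_mul_sub_integral_coth_mul
    (hf : DifferentiableOn ℂ f {θ : ℂ | |θ.im| < δ})
    {C R : ℝ} (hO : ∀ θ : ℂ, |θ.im| < δ → R ≤ |θ.re| → ‖f θ‖ ≤ C / θ.re ^ 2)
    {θ : ℂ} {ε : ℝ} (hε : 0 < ε) (hεπ : ε < Real.pi)
    (ha : |θ.im + ε| < δ) (hb : |θ.im - ε| < δ) {F : ℂ → ℂ}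
    (hF : ∀ z, F z = cosh (z - θ) / sinh (z - θ) * f z)
    (hFa : Integrable fun t : ℝ => F (t + (θ.im + ε : ℝ) * I))
    (hFb : Integrable fun t : ℝ => F (t + (θ.im - ε : ℝ) * I)) :
    (∫ t : ℝ, F (t + (θ.im + ε : ℝ) * I)) - ∫ t : ℝ, F (t + (θ.im - ε : ℝ) * I) =
      -2 * Real.pi * I * f θ := by
  set s := uIcc (θ.im + ε) (θ.im - ε) with hs_def
  have hs : ∀ c ∈ s, |c| < δ := fun c hc => by
    simpa using abs_sub_lt_of_mem_uIcc (x := 0) (by simpa using ha) (by simpa using hb) hc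
  have hsπ : ∀ c ∈ s, |c - θ.im| < Real.pi := fun c hc =>
    abs_sub_lt_of_mem_uIcc (by simpa [abs_of_pos hε] using hεπ)
      (by simpa [abs_of_pos hε] using hεπ) hc
  have hθs : θ.im ∈ Ioo (θ.im - ε) (θ.im + ε) := ⟨by linarith, by linarith⟩
  have hnhds : im ⁻¹' s ∈ 𝓝 θ :=
    continuous_im.continuousAt.preimage_mem_nhds <| by
      rw [hs_def, uIcc_of_ge (by linarith)]
      exact Icc_mem_nhds hθs.1 hθs.2
  set P : ℂ → ℂ := fun z => cosh (z - θ) * f z / dslope sinh 0 (z - θ) with hP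
  have hPd : DifferentiableOn ℂ P (im ⁻¹' s) := by
    refine DifferentiableOn.div (DifferentiableOn.mul
      (Differentiable.differentiableOn (by fun_prop)) (hf.mono fun z hz => hs _ hz)) ?_ fun z hz => dslope_sinh_ne_zero (by simpa using hsπ _ hz)
    exact (differentiable_dslope_sinh.comp (by fun_prop : Differentiable ℂ fun z => z - θ))
      |>.differentiableOn
  have hPθ : P θ = f θ := by simp [hP]
  have hG : ∀ z, z ≠ θ → dslope P θ z = F z - f θ * (z - θ)⁻¹ := fun z hz => by
    have hz' := sub_ne_zero.2 hz
    rw [dslope_of_ne _ hz, slope_def_field, hPθ, hP, hF, ← mul_dslope_sinh, sub_div,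
      div_div, mul_comm (dslope _ _ _), div_eq_mul_inv (f θ), div_mul_eq_mul_div]
  have hlim : Tendsto (dslope P θ) (stripEnds s) (𝓝 0) := by
    have hre : Tendsto (fun z : ℂ => |z.re| - |θ.re|) (stripEnds s) atTop :=
      tendsto_atTop_add_const_right _ _ (tendsto_abs_re_stripEnds s)
    have hle : ∀ z : ℂ, |z.re| - |θ.re| ≤ |(z - θ).re| := fun z => by
      simpa using abs_sub_abs_le_abs_sub z.re θ.re
    have h1 : Tendsto F (stripEnds s) (𝓝 0) := by
      rw [funext hF]
      refine tendsto_mul_stripEnds_zero hs hO (B := 2) ?_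
      filter_upwards [hre.eventually_ge_atTop 1] with z hz
      exact norm_cosh_div_sinh_le (hz.trans (hle z))
    have h2 : Tendsto (fun z : ℂ => z - θ) (stripEnds s) (Bornology.cobounded ℂ) :=
      tendsto_norm_atTop_iff_cobounded.1 <|
        tendsto_atTop_mono (fun z => (hle z).trans (abs_re_le_norm _)) hre
    have h3 := h1.sub ((tendsto_inv₀_cobounded.comp h2).const_mul (f θ))
    rw [mul_zero, sub_zero] at h3
    refine h3.congr' ?_
    filter_upwards [hre.eventually_gt_atTop 0] with z hz
    refine (hG z ?_).symm
    rintro rfl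
    simp at hz
  have hne : ∀ c : ℝ, c ≠ θ.im → ∀ t : ℝ, (t + c * I : ℂ) ≠ θ := fun c hc t h =>
    hc (by simpa using congrArg im h)
  have hdiff : ∀ t : ℝ, dslope P θ (t + (θ.im + ε : ℝ) * I) - dslope P θ (t + (θ.im - ε : ℝ) * I) =
      (F (t + (θ.im + ε : ℝ) * I) - F (t + (θ.im - ε : ℝ) * I)) -
        f θ * (-2 * Real.pi * I) *
          (ProbabilityTheory.cauchyPDFReal θ.re ε.toNNReal t : ℝ) := fun t => by
    rw [hG _ (hne _ (by linarith [hθs.2]) t), hG _ (hne _ (by linarith [hθs.1]) t)]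
    linear_combination -f θ * inv_sub_inv_eq_cauchyPDFReal θ hε t
  have hcauchy : Integrable fun t : ℝ => f θ * (-2 * Real.pi * I) *
      (ProbabilityTheory.cauchyPDFReal θ.re ε.toNNReal t : ℂ) :=
    (ProbabilityTheory.integrable_cauchyPDFReal _).ofReal.const_mul _
  have key := integral_sub_eq_zero_of_tendsto_stripEnds
    ((differentiableOn_dslope hnhds).2 hPd) hlim
    (by simp_rw [hdiff]; exact (hFa.sub hFb).sub hcauchy)
  simp_rw [hdiff] at key
  replace key := (integral_sub (hFa.sub hFb) hcauchy).symm.trans key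
  simp only [Pi.sub_apply] at key
  rw [integral_sub hFa hFb, integral_const_mul, integral_complex_ofReal,
    ProbabilityTheory.integral_cauchyPDFReal_eq_one _ (Real.toNNReal_pos.2 hε).ne'] at key
  rw [ofReal_one] at key
  linear_combination key

lemma tanhIntegral_add_sub_tanhIntegral_sub (hf : DifferentiableOn ℂ f {θ : ℂ | |θ.im| < δ})
    {C R : ℝ} (hO : ∀ θ : ℂ, |θ.im| < δ → R ≤ |θ.re| → ‖f θ‖ ≤ C / θ.re ^ 2)
    {θ : ℂ} {ε : ℝ} (hε : 0 < ε) (hεπ : ε < Real.pi)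
    (ha : |θ.im + ε| < δ) (hb : |θ.im - ε| < δ) :
    tanhIntegral f (θ.im + ε) (θ + (Real.pi / 2 : ℝ) * I) -
      tanhIntegral f (θ.im - ε) (θ - (Real.pi / 2 : ℝ) * I) = -I * f θ := by
  have hia := integrable_tanh_mul hf hO ha (θ := θ + (Real.pi / 2 : ℝ) * I) (by
    simp only [add_im, mul_im, ofReal_re, I_im, ofReal_im, I_re]
    rw [abs_lt]
    constructor <;> linarith)
  have hib := integrable_tanh_mul hf hO hb (θ := θ - (Real.pi / 2 : ℝ) * I) (by
    simp only [sub_im, mul_im, ofReal_re, I_im, ofReal_im, I_re]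
    rw [abs_lt]
    constructor <;> linarith)
  simp only [tanhIntegral]
  simp only [← sub_sub, tanh_sub_pi_div_two_mul_I] at hia ⊢
  simp only [← sub_add, tanh_add_pi_div_two_mul_I] at hib ⊢
  have key := integral_coth_mul_sub_integral_coth_mul hf hO hε hεπ ha hb (fun _ => rfl) hia hib
  rw [← mul_sub, key]
  have hpi : (Real.pi : ℂ) ≠ 0 := ofReal_ne_zero.2 Real.pi_ne_zero
  field_simp

end ShiftedKernel

end Helpers

/-- Let `δ > 0` and let `f` be analytic on the strip `{θ : |Im θ| < δ}` with
`|f(θ)| = O(1/(Re θ)²)` as `|Re θ| → ∞`, uniformly in the strip. Then there is an analytic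
function `ν` on the strip `{θ : |Im θ| < π/2 + δ}` with
`ν(θ) = (1/2π) ∫ tanh(θ′ − θ) f(θ′) dθ′` for real `θ`, and
`ν(θ + iπ/2) − ν(θ − iπ/2) = −i f(θ)` whenever `|Im θ| < δ`. -/
theorem tanh_kernel_continuation
    (δ : ℝ) (hδ : 0 < δ) (f : ℂ → ℂ)
    (hf : DifferentiableOn ℂ f {θ : ℂ | |θ.im| < δ})
    (hO : ∃ C R : ℝ, 0 < C ∧ 0 < R ∧
      ∀ θ : ℂ, |θ.im| < δ → R ≤ |θ.re| → ‖f θ‖ ≤ C / θ.re ^ 2) :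
    ∃ ν : ℂ → ℂ,
      DifferentiableOn ℂ ν {θ : ℂ | |θ.im| < Real.pi / 2 + δ} ∧
      (∀ x : ℝ, ν (x : ℂ) =
        (1 / (2 * (Real.pi : ℂ))) * ∫ t : ℝ, Complex.tanh ((t : ℂ) - (x : ℂ)) * f (t : ℂ)) ∧
      (∀ θ : ℂ, |θ.im| < δ →
        ν (θ + (Real.pi / 2 : ℝ) * Complex.I) - ν (θ - (Real.pi / 2 : ℝ) * Complex.I)
          = -Complex.I * f θ) := by
  obtain ⟨C, R, -, -, hO⟩ := hO
  have hπ := Real.pi_pos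
  set k : ℝ := δ / (Real.pi / 2 + δ) with hk
  have hk0 : 0 < k := by positivity
  have hkδ : k * (Real.pi / 2 + δ) = δ := div_mul_cancel₀ _ (by positivity)
  have hk1 : k < 1 := by rw [hk, div_lt_one (by positivity)]; linarith
  have hline : ∀ y : ℝ, |y| < Real.pi / 2 + δ → |k * y| < δ ∧ |k * y - y| < Real.pi / 2 := by
    intro y hy
    have hsub : k * y - y = -((1 - k) * y) := by ring
    rw [hsub, abs_neg, abs_mul, abs_mul, abs_of_pos hk0, abs_of_pos (sub_pos.2 hk1)]
    constructor <;> nlinarith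
  have heq : ∀ c : ℝ, |c| < δ → ∀ θ : ℂ, |θ.im| < Real.pi / 2 + δ → |c - θ.im| < Real.pi / 2 →
      tanhIntegral f (k * θ.im) θ = tanhIntegral f c θ := fun c hc θ hθ hcθ =>
    tanhIntegral_eq_of_abs_lt hf hO (hline _ hθ).1 hc (hline _ hθ).2 hcθ
  refine ⟨fun θ => tanhIntegral f (k * θ.im) θ, fun θ hθ => ?_, fun x => ?_, fun θ hθ => ?_⟩
  · obtain ⟨h1, h2⟩ := hline _ hθ
    refine ((differentiableAt_tanhIntegral hf hO h1 h2).congr_of_eventuallyEq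
      ?_).differentiableWithinAt
    have hU : IsOpen {w : ℂ | |w.im| < Real.pi / 2 + δ} := isOpen_lt (by fun_prop) continuous_const
    have hV : IsOpen {w : ℂ | |k * θ.im - w.im| < Real.pi / 2} :=
      isOpen_lt (by fun_prop) continuous_const
    filter_upwards [hU.mem_nhds hθ, hV.mem_nhds h2] with w hw hw'
    exact heq _ h1 w hw hw'
  · simp [tanhIntegral]
  · obtain ⟨ε, hε, hεm⟩ := exists_between (lt_min (sub_pos.2 hθ) hπ)
    obtain ⟨hεδ, hεπ⟩ := lt_min_iff.1 hεm
    have hθ' := abs_lt.1 hθ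
    have ha : |θ.im + ε| < δ := (abs_add_le _ _).trans_lt (by rw [abs_of_pos hε]; linarith)
    have hb : |θ.im - ε| < δ := (abs_sub _ _).trans_lt (by rw [abs_of_pos hε]; linarith)
    have him₁ : (θ + (Real.pi / 2 : ℝ) * I).im = θ.im + Real.pi / 2 := by simp
    have him₂ : (θ - (Real.pi / 2 : ℝ) * I).im = θ.im - Real.pi / 2 := by simp
    rw [← tanhIntegral_add_sub_tanhIntegral_sub hf hO hε hεπ ha hb]
    refine congrArg₂ _ (heq _ ha _ ?_ ?_) (heq _ hb _ ?_ ?_)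
    all_goals
      simp only [him₁, him₂]
      rw [abs_lt]
      constructor <;> linarith
end

section
/- Let δ > 0 and let g be a bounded analytic function on the strip {θ ∈ ℂ : |Im θ| < δ}. Then there exists an analytic function η on the strip {θ ∈ ℂ : |Im θ| < π/2 + δ} such that η(θ) = (1/2π)∫_ℝ sech(θ′ − θ) g(θ′) dθ′ for all real θ, and for every θ with |Im θ| < δ one has η(θ + iπ/2) + η(θ − iπ/2) = g(θ). -/
open Complex MeasureTheory

open Set Filter Topology

lemma Real.cosh_sub_inv_le (x y : ℝ) :
    (Real.cosh (x - y))⁻¹ ≤ Real.exp |y| * (Real.cosh x)⁻¹ := by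
  have h : Real.cosh x ≤ Real.exp |y| * Real.cosh (x - y) := by
    rw [Real.cosh_eq, Real.cosh_eq]
    have h1 : Real.exp x = Real.exp y * Real.exp (x - y) := by
      rw [← Real.exp_add]; ring_nf
    have h2 : Real.exp (-x) = Real.exp (-y) * Real.exp (-(x - y)) := by
      rw [← Real.exp_add]; ring_nf
    have h3 : Real.exp y ≤ Real.exp |y| := Real.exp_le_exp.2 (le_abs_self y)
    have h4 : Real.exp (-y) ≤ Real.exp |y| := Real.exp_le_exp.2 (neg_le_abs y)
    rw [h1, h2]
    nlinarith [Real.exp_pos (x - y), Real.exp_pos (-(x - y))]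
  rw [inv_le_iff_one_le_mul₀ (by positivity)]
  field_simp
  linarith

lemma Real.one_add_sq_le_two_mul_cosh (x : ℝ) : 1 + x ^ 2 ≤ 2 * Real.cosh x := by
  have h := Real.cosh_sq (x / 2)
  have h2 := Real.cosh_two_mul (x / 2)
  have h3 : (x / 2) ^ 2 ≤ Real.sinh (x / 2) ^ 2 := by
    rw [sq_le_sq, Real.abs_sinh]
    exact Real.self_le_sinh_iff.2 (abs_nonneg _)
  rw [show 2 * (x / 2) = x by ring] at h2
  nlinarith

lemma Real.integrable_inv_cosh : Integrable fun x : ℝ ↦ (Real.cosh x)⁻¹ := by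
  refine (integrable_inv_one_add_sq.const_mul 2).mono'
    (Real.continuous_cosh.inv₀ fun x ↦ (Real.cosh_pos x).ne').aestronglyMeasurable
    (ae_of_all _ fun x ↦ ?_)
  have h := Real.one_add_sq_le_two_mul_cosh x
  rw [Real.norm_of_nonneg (by positivity), inv_le_iff_one_le_mul₀ (by positivity)]
  field_simp
  linarith

lemma Real.integral_inv_cosh : ∫ x : ℝ, (Real.cosh x)⁻¹ = Real.pi := by
  have hd : ∀ x : ℝ, HasDerivAt (fun x ↦ Real.arctan (Real.sinh x)) (Real.cosh x)⁻¹ x := by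
    intro x
    convert (Real.hasDerivAt_sinh x).arctan using 1
    rw [add_comm, ← Real.cosh_sq]
    field_simp
  rw [integral_of_hasDerivAt_of_tendsto hd Real.integrable_inv_cosh
    ((tendsto_nhds_of_tendsto_nhdsWithin Real.tendsto_arctan_atBot).comp
      Real.sinhOrderIso.tendsto_atBot)
    ((tendsto_nhds_of_tendsto_nhdsWithin Real.tendsto_arctan_atTop).comp
      Real.sinhOrderIso.tendsto_atTop)]
  ring

lemma Real.tendsto_inv_cosh_atTop : Tendsto (fun x : ℝ ↦ (Real.cosh x)⁻¹) atTop (𝓝 0) := by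
  refine tendsto_inv_atTop_zero.comp (tendsto_atTop_mono (fun x ↦ ?_) tendsto_id)
  have h := Real.one_add_sq_le_two_mul_cosh x
  simp only [id]
  nlinarith [sq_nonneg (x - 1)]

lemma abs_sub_le_max_of_mem_uIcc {a b x : ℝ} (hx : x ∈ uIcc a b) (y : ℝ) :
    |x - y| ≤ max |a - y| |b - y| := by
  have ha := abs_le.1 (le_max_left |a - y| |b - y|)
  have hb := abs_le.1 (le_max_right |a - y| |b - y|)
  rw [abs_le]
  rcases mem_uIcc.1 hx with h | h <;> constructor <;> linarith

lemma Real.cos_pos_and_cos_le_cos {ρ x : ℝ} (hρ : ρ < Real.pi / 2) (hx : |x| ≤ ρ) :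
    0 < Real.cos ρ ∧ Real.cos ρ ≤ Real.cos x := by
  have hρ0 : 0 ≤ ρ := (abs_nonneg _).trans hx
  refine ⟨Real.cos_pos_of_mem_Ioo ⟨by linarith, hρ⟩, ?_⟩
  rw [← Real.cos_abs x]
  exact Real.cos_le_cos_of_nonneg_of_le_pi (abs_nonneg _) (by linarith) hx

namespace Complex

lemma cosh_re (z : ℂ) : (cosh z).re = Real.cos z.im * Real.cosh z.re := by
  conv_lhs => rw [← re_add_im z, cosh_add, cosh_mul_I, sinh_mul_I]
  simp [← ofReal_cosh, ← ofReal_sinh, ← ofReal_cos, ← ofReal_sin, mul_comm]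

lemma norm_inv_cosh_le {z : ℂ} (hz : 0 < Real.cos z.im) :
    ‖(cosh z)⁻¹‖ ≤ (Real.cos z.im)⁻¹ * (Real.cosh z.re)⁻¹ := by
  rw [norm_inv, ← mul_inv]
  refine inv_anti₀ (by positivity) ?_
  rw [← cosh_re]
  exact re_le_norm _

lemma cosh_ne_zero_of_abs_im_lt {z : ℂ} (hz : |z.im| < Real.pi / 2) : cosh z ≠ 0 := by
  intro h
  have := Real.cos_pos_of_mem_Ioo (abs_lt.1 hz)
  have hre := cosh_re z
  rw [h, zero_re] at hre
  have : 0 < Real.cos z.im * Real.cosh z.re := by positivity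
  linarith

lemma norm_sinh_le (z : ℂ) : ‖sinh z‖ ≤ Real.cosh z.re := by
  rw [sinh, Real.cosh_eq, norm_div, RCLike.norm_ofNat]
  gcongr
  refine (norm_sub_le _ _).trans_eq ?_
  simp [norm_exp]

lemma abs_sinh_re_le_norm_sinh (z : ℂ) : |Real.sinh z.re| ≤ ‖sinh z‖ := by
  rw [sinh, Real.sinh_eq, norm_div, RCLike.norm_ofNat, abs_div, abs_two]
  gcongr
  refine le_trans (le_of_eq ?_) (abs_norm_sub_norm_le _ _)
  simp [norm_exp]

lemma sinh_ne_zero_of_abs_im_lt {z : ℂ} (hz : |z.im| < Real.pi) (h0 : z ≠ 0) :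
    sinh z ≠ 0 := by
  intro h
  have h1 := abs_sinh_re_le_norm_sinh z
  rw [h, norm_zero, abs_nonpos_iff, Real.sinh_eq_zero] at h1
  have h2 : z = z.im * I := by apply Complex.ext <;> simp [h1]
  rw [h2, sinh_mul_I, ← ofReal_sin] at h
  have h3 : Real.sin z.im = 0 := by
    simpa only [mul_eq_zero, I_ne_zero, or_false, ofReal_eq_zero] using h
  rw [Real.sin_eq_zero_iff_of_lt_of_lt (abs_lt.1 hz).1 (abs_lt.1 hz).2] at h3
  exact h0 (Complex.ext h1 h3)

/-- Contour shift between two horizontal lines for functions decaying like `sech`. -/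
lemma integral_horizontal_eq {f : ℂ → ℂ} {a b M : ℝ}
    (hd : ∀ z : ℂ, z.im ∈ uIcc a b → DifferentiableAt ℂ f z)
    (hM : ∀ z : ℂ, z.im ∈ uIcc a b → ‖f z‖ ≤ M * (Real.cosh z.re)⁻¹) :
    ∫ t : ℝ, f (t + a * I) = ∫ t : ℝ, f (t + b * I) := by
  have hint : ∀ c ∈ uIcc a b, Integrable fun t : ℝ ↦ f (t + c * I) := by
    intro c hc
    refine (Real.integrable_inv_cosh.const_mul M).mono' ?_ (ae_of_all _ fun t ↦ ?_)
    · refine (continuous_iff_continuousAt.2 fun t ↦ ?_).aestronglyMeasurable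
      exact ContinuousAt.comp (f := fun t : ℝ ↦ (t + c * I : ℂ))
        (hd _ (by simpa using hc)).continuousAt (by fun_prop)
    · simpa using hM (t + c * I) (by simpa using hc)
  have hvert : ∀ s : ℝ → ℝ, (∀ T, Real.cosh (s T) = Real.cosh T) →
      Tendsto (fun T ↦ I • ∫ y in a..b, f (s T + y * I)) atTop (𝓝 0) := by
    intro s hs
    refine squeeze_zero_norm (a := fun T ↦ M * (Real.cosh T)⁻¹ * |b - a|) (fun T ↦ ?_) ?_
    · rw [norm_smul, norm_I, one_mul]
      refine intervalIntegral.norm_integral_le_of_norm_le_const fun y hy ↦ ?_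
      simpa [hs] using hM (s T + y * I) (by simpa using uIoc_subset_uIcc hy)
    · simpa using (Real.tendsto_inv_cosh_atTop.const_mul M).mul_const |b - a|
  have hrect : ∀ T : ℝ, (∫ x in (-T)..T, f (x + a * I)) - (∫ x in (-T)..T, f (x + b * I)) +
      I • (∫ y in a..b, f (T + y * I)) - I • (∫ y in a..b, f ((-T : ℝ) + y * I)) = 0 := by
    intro T
    simpa using integral_boundary_rect_eq_zero_of_differentiableOn f (-T + a * I) (T + b * I)
      fun z hz ↦ (hd z (by simpa using hz.2)).differentiableWithinAt
  have hlim := (((intervalIntegral_tendsto_integral (hint a left_mem_uIcc)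
    tendsto_neg_atTop_atBot tendsto_id).sub (intervalIntegral_tendsto_integral
    (hint b right_mem_uIcc) tendsto_neg_atTop_atBot tendsto_id)).add
    (hvert (fun T ↦ T) fun T ↦ rfl)).sub (hvert (fun T ↦ -T) Real.cosh_neg)
  simp only [id, hrect] at hlim
  have := tendsto_nhds_unique hlim tendsto_const_nhds
  simpa [sub_eq_zero] using this

/-- Convolution of `g` with the kernel `sech / 2π` along the line `Im z = c`. -/
noncomputable def sechTransform (g : ℂ → ℂ) (c : ℝ) (θ : ℂ) : ℂ :=
  (1 / (2 * (Real.pi : ℂ))) * ∫ t : ℝ, (cosh (t + c * I - θ))⁻¹ * g (t + c * I)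

lemma norm_inv_cosh_sub_le {ρ R : ℝ} (hρ : ρ < Real.pi / 2) {z θ : ℂ}
    (hz : |z.im - θ.im| ≤ ρ) (hR : |θ.re| ≤ R) :
    ‖(cosh (z - θ))⁻¹‖ ≤ (Real.cos ρ)⁻¹ * (Real.exp R * (Real.cosh z.re)⁻¹) := by
  obtain ⟨hcos, hle⟩ := Real.cos_pos_and_cos_le_cos hρ hz
  rw [← sub_im] at hle
  refine (norm_inv_cosh_le (hcos.trans_le hle)).trans ?_
  gcongr
  rw [sub_re]
  refine (Real.cosh_sub_inv_le _ _).trans ?_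
  gcongr

lemma norm_sinh_mul_inv_cosh_sub_le {ρ : ℝ} (hρ : ρ < Real.pi / 2) {z θ : ℂ}
    (hz : |z.im - θ.im| ≤ ρ) :
    ‖sinh (z - θ) * (cosh (z - θ))⁻¹‖ ≤ (Real.cos ρ)⁻¹ := by
  obtain ⟨hcos, hle⟩ := Real.cos_pos_and_cos_le_cos hρ hz
  rw [← sub_im] at hle
  have h := Real.cosh_pos (z - θ).re
  rw [norm_mul]
  calc _ ≤ Real.cosh (z - θ).re * ((Real.cos (z - θ).im)⁻¹ * (Real.cosh (z - θ).re)⁻¹) := by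
        gcongr
        · exact norm_sinh_le _
        · exact norm_inv_cosh_le (hcos.trans_le hle)
    _ = (Real.cos (z - θ).im)⁻¹ := by field_simp
    _ ≤ _ := by gcongr

variable {δ C : ℝ} {g : ℂ → ℂ} {c c' : ℝ} {θ : ℂ}

lemma continuous_horizontal (hg : DifferentiableOn ℂ g {θ : ℂ | |θ.im| < δ}) (hc : |c| < δ) :
    Continuous fun t : ℝ ↦ g (t + c * I) :=
  hg.continuousOn.comp_continuous (by fun_prop) fun t ↦ by simpa using hc

lemma continuous_inv_cosh_horizontal (hθ : |c - θ.im| < Real.pi / 2) :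
    Continuous fun t : ℝ ↦ (cosh (t + c * I - θ))⁻¹ :=
  (continuous_cosh.comp (by fun_prop)).inv₀
    fun t ↦ cosh_ne_zero_of_abs_im_lt (by simpa using hθ)

lemma integrable_sech_mul (hg : DifferentiableOn ℂ g {θ : ℂ | |θ.im| < δ})
    (hC : ∀ θ : ℂ, |θ.im| < δ → ‖g θ‖ ≤ C) (hc : |c| < δ) (hθ : |c - θ.im| < Real.pi / 2) :
    Integrable fun t : ℝ ↦ (cosh (t + c * I - θ))⁻¹ * g (t + c * I) := by
  refine Integrable.mul_bdd (c := C) ?_ (continuous_horizontal hg hc).aestronglyMeasurable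
    (ae_of_all _ fun t ↦ hC _ (by simpa using hc))
  refine ((Real.integrable_inv_cosh.const_mul (Real.exp |θ.re|)).const_mul
    (Real.cos |c - θ.im|)⁻¹).mono'
    (continuous_inv_cosh_horizontal hθ).aestronglyMeasurable (ae_of_all _ fun t ↦ ?_)
  simpa using norm_inv_cosh_sub_le (z := t + c * I) hθ (by simp) le_rfl

lemma differentiableAt_sechTransform (hg : DifferentiableOn ℂ g {θ : ℂ | |θ.im| < δ})
    (hC : ∀ θ : ℂ, |θ.im| < δ → ‖g θ‖ ≤ C) (hc : |c| < δ) (hθ : |c - θ.im| < Real.pi / 2) :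
    DifferentiableAt ℂ (sechTransform g c) θ := by
  obtain ⟨ρ, hρ1, hρ2⟩ := exists_between hθ
  have hρ0 : 0 < Real.cos ρ :=
    Real.cos_pos_of_mem_Ioo ⟨by linarith [abs_nonneg (c - θ.im)], hρ2⟩
  set R := |θ.re| + 1
  set U : Set ℂ := {w | |c - w.im| < ρ ∧ |w.re| < R}
  have hU : U ∈ 𝓝 θ := by
    refine IsOpen.mem_nhds ?_ ⟨hρ1, by simp [R]⟩
    refine IsOpen.and (isOpen_lt ?_ ?_) (isOpen_lt ?_ ?_) <;> fun_prop
  have hU' : ∀ w ∈ U, |c - w.im| < Real.pi / 2 := fun w hw ↦ hw.1.trans hρ2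
  have hcont := continuous_horizontal hg hc
  have hker := continuous_inv_cosh_horizontal hθ
  refine DifferentiableAt.const_mul (HasDerivAt.differentiableAt
    (hasDerivAt_integral_of_dominated_loc_of_deriv_le (s := U) hU ?_
    (integrable_sech_mul hg hC hc hθ)
    (F' := fun w t ↦ sinh (t + c * I - w) * (cosh (t + c * I - w))⁻¹ *
      (cosh (t + c * I - w))⁻¹ * g (t + c * I))
    (bound := fun t ↦ (Real.cos ρ)⁻¹ * ((Real.cos ρ)⁻¹ * (Real.exp R * (Real.cosh t)⁻¹)) * C)
    ?_ ?_ ?_ ?_).2) _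
  · filter_upwards [hU] with w hw
    exact ((continuous_inv_cosh_horizontal (hU' w hw)).mul hcont).aestronglyMeasurable
  · exact ((((continuous_sinh.comp (by fun_prop)).mul hker).mul hker).mul
      hcont).aestronglyMeasurable
  · refine ae_of_all _ fun t w hw ↦ ?_
    have him : |((t : ℂ) + c * I).im - w.im| ≤ ρ := by simpa using hw.1.le
    have h1 := norm_inv_cosh_sub_le hρ2 him hw.2.le
    have h2 := norm_sinh_mul_inv_cosh_sub_le hρ2 him
    have h3 := hC (t + c * I) (by simpa using hc)
    rw [norm_mul, norm_mul]
    gcongr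
    simpa using h1
  · exact (((Real.integrable_inv_cosh.const_mul _).const_mul _).const_mul _).mul_const _
  · refine ae_of_all _ fun t w hw ↦ ?_
    have hne : cosh (t + c * I - w) ≠ 0 := cosh_ne_zero_of_abs_im_lt (by simpa using hU' w hw)
    have h := ((((hasDerivAt_id w).const_sub (t + c * I)).ccosh).inv hne).mul_const (g (t + c * I))
    refine h.congr_deriv ?_
    simp only [id]
    field_simp

lemma sechTransform_eq (hg : DifferentiableOn ℂ g {θ : ℂ | |θ.im| < δ})
    (hC : ∀ θ : ℂ, |θ.im| < δ → ‖g θ‖ ≤ C) (hc : |c| < δ) (hc' : |c'| < δ)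
    (hθ : |c - θ.im| < Real.pi / 2) (hθ' : |c' - θ.im| < Real.pi / 2) :
    sechTransform g c θ = sechTransform g c' θ := by
  set ρ := max |c - θ.im| |c' - θ.im|
  have hρ : ρ < Real.pi / 2 := max_lt hθ hθ'
  have hstrip : ∀ x ∈ uIcc c c', |x| < δ ∧ |x - θ.im| ≤ ρ := by
    intro x hx
    have h := abs_sub_le_max_of_mem_uIcc hx 0
    simp only [sub_zero] at h
    exact ⟨h.trans_lt (max_lt hc hc'), abs_sub_le_max_of_mem_uIcc hx _⟩
  unfold sechTransform
  congr 1
  refine integral_horizontal_eq (f := fun z ↦ (cosh (z - θ))⁻¹ * g z)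
    (M := (Real.cos ρ)⁻¹ * Real.exp |θ.re| * C) (fun z hz ↦ ?_) (fun z hz ↦ ?_)
  · obtain ⟨h1, h2⟩ := hstrip _ hz
    refine DifferentiableAt.mul (DifferentiableAt.inv (by fun_prop)
      (cosh_ne_zero_of_abs_im_lt (h2.trans_lt hρ))) (hg.differentiableAt ?_)
    exact (isOpen_lt (by fun_prop) (by fun_prop)).mem_nhds h1
  · obtain ⟨h1, h2⟩ := hstrip _ hz
    rw [norm_mul]
    calc _ ≤ ((Real.cos ρ)⁻¹ * (Real.exp |θ.re| * (Real.cosh z.re)⁻¹)) * C := by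
          gcongr
          · exact (norm_nonneg _).trans (norm_inv_cosh_sub_le hρ h2 le_rfl)
          · exact norm_inv_cosh_sub_le hρ h2 le_rfl
          · exact hC z h1
      _ = _ := by ring

lemma sechTransform_one (hθ : |c - θ.im| < Real.pi / 2) :
    sechTransform (fun _ ↦ 1) c θ = 1 / 2 := by
  have hθ' : |θ.im - θ.im| < Real.pi / 2 := by simpa using Real.pi_div_two_pos
  rw [sechTransform_eq (δ := max |c| |θ.im| + 1) (C := 1) (c' := θ.im)
    (differentiable_const 1).differentiableOn (by simp)
    ((le_max_left _ _).trans_lt (lt_add_one _)) ((le_max_right _ _).trans_lt (lt_add_one _)) hθ hθ',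
    sechTransform]
  have h : ∀ t : ℝ, (cosh (t + θ.im * I - θ))⁻¹ * (1 : ℂ) = ((Real.cosh (t - θ.re))⁻¹ : ℝ) := by
    intro t
    have : (t + θ.im * I - θ : ℂ) = ((t - θ.re : ℝ) : ℂ) := by
      apply Complex.ext <;> simp
    rw [this]
    simp
  simp_rw [h]
  rw [integral_complex_ofReal, integral_sub_right_eq_self (fun t ↦ (Real.cosh t)⁻¹),
    Real.integral_inv_cosh]
  have : (Real.pi : ℂ) ≠ 0 := by simp [Real.pi_ne_zero]
  field_simp

/-- Across the pole at `θ`, where `g` vanishes, the contour shift for the kernel `1 / sinh`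
leaves no residue. -/
lemma integral_div_sinh_eq (hg : DifferentiableOn ℂ g {θ : ℂ | |θ.im| < δ})
    (hC : ∀ θ : ℂ, |θ.im| < δ → ‖g θ‖ ≤ C) (hθ : |θ.im| < δ) (h0 : g θ = 0)
    (hc : |c| < δ) (hc' : |c'| < δ) (hcθ : |c - θ.im| < Real.pi) (hcθ' : |c' - θ.im| < Real.pi)
    (hne : c ≠ θ.im) (hne' : c' ≠ θ.im) :
    ∫ t : ℝ, g (t + c * I) / sinh (t + c * I - θ) =
      ∫ t : ℝ, g (t + c' * I) / sinh (t + c' * I - θ) := by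
  have hC0 : 0 ≤ C := (norm_nonneg _).trans (hC _ hθ)
  set F : ℂ → ℂ := fun z ↦ dslope g θ z / dslope sinh 0 (z - θ)
  have hF : ∀ z, z ≠ θ → g z / sinh (z - θ) = F z := by
    intro z hz
    have hz' : z - θ ≠ 0 := sub_ne_zero.2 hz
    simp only [F]
    rw [dslope_of_ne _ hz, dslope_of_ne _ hz', slope_def_field, slope_def_field, h0]
    simp only [sub_zero, sinh_zero]
    field_simp
  have hline : ∀ x : ℝ, x ≠ θ.im → ∀ t : ℝ, (t + x * I : ℂ) ≠ θ := by
    intro x hx t h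
    exact hx (by simpa using congrArg im h)
  have hopen : IsOpen {z : ℂ | |z.im| < δ} := isOpen_lt (by fun_prop) (by fun_prop)
  have hstrip : ∀ x ∈ uIcc c c', |x| < δ ∧ |x - θ.im| < Real.pi := by
    intro x hx
    have h := abs_sub_le_max_of_mem_uIcc hx 0
    simp only [sub_zero] at h
    exact ⟨h.trans_lt (max_lt hc hc'),
      (abs_sub_le_max_of_mem_uIcc hx _).trans_lt (max_lt hcθ hcθ')⟩
  have hd : ∀ z : ℂ, z.im ∈ uIcc c c' → DifferentiableAt ℂ F z := by
    intro z hz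
    obtain ⟨h1, h2⟩ := hstrip _ hz
    have hs : Differentiable ℂ (dslope sinh 0) := by
      rw [← differentiableOn_univ, differentiableOn_dslope univ_mem]
      exact differentiable_sinh.differentiableOn
    refine DifferentiableAt.div ?_ (hs.differentiableAt.comp z (by fun_prop)) ?_
    · exact ((differentiableOn_dslope (hopen.mem_nhds hθ)).2 hg).differentiableAt
        (hopen.mem_nhds h1)
    · by_cases hz0 : z - θ = 0
      · simp [hz0, dslope_same]
      · rw [dslope_of_ne _ hz0, slope_def_field]
        simp [hz0, sinh_ne_zero_of_abs_im_lt (z := z - θ) h2 hz0]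
  have hcpt : IsCompact (uIcc (θ.re - 1) (θ.re + 1) ×ℂ uIcc c c') :=
    isCompact_uIcc.reProdIm isCompact_uIcc
  obtain ⟨M, hM⟩ := hcpt.exists_bound_of_continuousOn (f := fun z ↦ F z * Real.cosh z.re)
    (fun z hz ↦ ((hd z hz.2).continuousAt.mul
      (by fun_prop)).continuousWithinAt)
  simp only [hF _ (hline c hne _), hF _ (hline c' hne' _)]
  refine integral_horizontal_eq (M := max M (2 * C * Real.exp |θ.re|)) hd fun z hz ↦ ?_
  have hcosh := Real.cosh_pos z.re
  obtain hre | hre := le_or_gt |z.re - θ.re| 1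
  · have h := hM z ⟨by
      rw [mem_preimage, uIcc_of_le (by linarith)]
      constructor <;> linarith [abs_le.1 hre], hz⟩
    rw [norm_mul, norm_real, Real.norm_of_nonneg hcosh.le] at h
    rw [← div_eq_mul_inv, le_div_iff₀ hcosh]
    exact h.trans (le_max_left _ _)
  · have hzθ : z ≠ θ := by
      rintro rfl
      simp at hre
      linarith
    rw [← hF z hzθ, norm_div]
    have h1 : Real.cosh (z.re - θ.re) / 2 ≤ ‖sinh (z - θ)‖ := by
      refine le_trans ?_ (abs_sinh_re_le_norm_sinh _)
      rw [sub_re]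
      refine le_of_sq_le_sq ?_ (abs_nonneg _)
      have h2 : |z.re - θ.re| ≤ |Real.sinh (z.re - θ.re)| := by
        rw [Real.abs_sinh]
        exact Real.self_le_sinh_iff.2 (abs_nonneg _)
      have h3 := Real.cosh_sq (z.re - θ.re)
      rw [← sq_abs (Real.sinh _)] at h3
      nlinarith
    calc ‖g z‖ / ‖sinh (z - θ)‖ ≤ C / (Real.cosh (z.re - θ.re) / 2) := by
          gcongr
          exact hC z (hstrip _ hz).1
      _ = 2 * C * (Real.cosh (z.re - θ.re))⁻¹ := by field_simp
      _ ≤ 2 * C * (Real.exp |θ.re| * (Real.cosh z.re)⁻¹) := by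
          gcongr
          exact Real.cosh_sub_inv_le _ _
      _ = 2 * C * Real.exp |θ.re| * (Real.cosh z.re)⁻¹ := by ring
      _ ≤ _ := by gcongr; exact le_max_right _ _

lemma sechTransform_add_const (hg : DifferentiableOn ℂ g {θ : ℂ | |θ.im| < δ})
    (hC : ∀ θ : ℂ, |θ.im| < δ → ‖g θ‖ ≤ C) (hc : |c| < δ) (hθ : |c - θ.im| < Real.pi / 2)
    (k : ℂ) : sechTransform (fun z ↦ g z + k) c θ = sechTransform g c θ + k / 2 := by
  have h1 := sechTransform_one hθ
  unfold sechTransform at h1 ⊢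
  have hone := integrable_sech_mul (g := fun _ ↦ 1) (δ := δ) (C := 1)
    (differentiable_const 1).differentiableOn (by simp) hc hθ
  have h : ∀ t : ℝ, (cosh (t + c * I - θ))⁻¹ * (g (t + c * I) + k) =
      (cosh (t + c * I - θ))⁻¹ * g (t + c * I) + (cosh (t + c * I - θ))⁻¹ * 1 * k := by
    intro t; ring
  simp_rw [h]
  rw [integral_add (integrable_sech_mul hg hC hc hθ) (hone.mul_const k), integral_mul_const,
    mul_add, ← mul_assoc, h1]
  ring

lemma sechTransform_add_half_pi (g : ℂ → ℂ) (c : ℝ) (θ : ℂ) :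
    sechTransform g c (θ + (Real.pi / 2 : ℝ) * I) =
      1 / (2 * (Real.pi : ℂ)) * (I * ∫ t : ℝ, g (t + c * I) / sinh (t + c * I - θ)) := by
  rw [sechTransform, ← integral_const_mul I]
  congr 2
  funext t
  rw [← sub_sub, cosh_sub, cosh_mul_I, sinh_mul_I, ← ofReal_cos, ← ofReal_sin,
    Real.cos_pi_div_two, Real.sin_pi_div_two]
  simp [mul_comm, div_eq_mul_inv, mul_left_comm]

lemma sechTransform_sub_half_pi (g : ℂ → ℂ) (c : ℝ) (θ : ℂ) :
    sechTransform g c (θ - (Real.pi / 2 : ℝ) * I) =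
      -(1 / (2 * (Real.pi : ℂ)) * (I * ∫ t : ℝ, g (t + c * I) / sinh (t + c * I - θ))) := by
  rw [sechTransform, ← integral_const_mul I, ← mul_neg, ← integral_neg]
  congr 2
  funext t
  rw [← sub_add, cosh_add, cosh_mul_I, sinh_mul_I, ← ofReal_cos, ← ofReal_sin,
    Real.cos_pi_div_two, Real.sin_pi_div_two]
  simp [mul_comm, div_eq_mul_inv, mul_left_comm]

lemma sechTransform_add_sechTransform (hg : DifferentiableOn ℂ g {θ : ℂ | |θ.im| < δ})
    (hC : ∀ θ : ℂ, |θ.im| < δ → ‖g θ‖ ≤ C) (hθ : |θ.im| < δ) (hc : |c| < δ) (hc' : |c'| < δ)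
    (hcθ : |c - (θ.im + Real.pi / 2)| < Real.pi / 2)
    (hcθ' : |c' - (θ.im - Real.pi / 2)| < Real.pi / 2) :
    sechTransform g c (θ + (Real.pi / 2 : ℝ) * I) +
      sechTransform g c' (θ - (Real.pi / 2 : ℝ) * I) = g θ := by
  set G : ℂ → ℂ := fun z ↦ g z - g θ
  have hG : DifferentiableOn ℂ G {θ : ℂ | |θ.im| < δ} := hg.sub_const _
  have hGC : ∀ z : ℂ, |z.im| < δ → ‖G z‖ ≤ C + C := fun z hz ↦
    (norm_sub_le _ _).trans (add_le_add (hC z hz) (hC θ hθ))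
  have hgG : g = fun z ↦ G z + g θ := by funext z; simp [G]
  have h1 := abs_lt.1 hcθ
  have h2 := abs_lt.1 hcθ'
  have hint := integral_div_sinh_eq hG hGC hθ (by simp [G]) hc hc'
    (abs_lt.2 ⟨by linarith, by linarith⟩) (abs_lt.2 ⟨by linarith, by linarith⟩)
    (by intro h; linarith) (by intro h; linarith)
  conv_lhs => rw [hgG]
  rw [sechTransform_add_const hG hGC hc (by simpa using hcθ),
    sechTransform_add_const hG hGC hc' (by simpa using hcθ'), sechTransform_add_half_pi,
    sechTransform_sub_half_pi, hint]
  ring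

end Complex

/-- Let `δ > 0` and let `g` be a bounded analytic function on the strip
`{θ : |Im θ| < δ}`. Then there is an analytic function `η` on the strip
`{θ : |Im θ| < π/2 + δ}` with `η(θ) = (1/2π) ∫ sech(θ′ − θ) g(θ′) dθ′` for real `θ`, and
`η(θ + iπ/2) + η(θ − iπ/2) = g(θ)` whenever `|Im θ| < δ`. -/
theorem sech_kernel_continuation
    (δ : ℝ) (hδ : 0 < δ) (g : ℂ → ℂ)
    (hg : DifferentiableOn ℂ g {θ : ℂ | |θ.im| < δ})
    (hbd : ∃ C : ℝ, ∀ θ : ℂ, |θ.im| < δ → ‖g θ‖ ≤ C) :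
    ∃ η : ℂ → ℂ,
      DifferentiableOn ℂ η {θ : ℂ | |θ.im| < Real.pi / 2 + δ} ∧
      (∀ x : ℝ, η (x : ℂ) =
        (1 / (2 * (Real.pi : ℂ))) * ∫ t : ℝ, (Complex.cosh ((t : ℂ) - (x : ℂ)))⁻¹ * g (t : ℂ)) ∧
      (∀ θ : ℂ, |θ.im| < δ →
        η (θ + (Real.pi / 2 : ℝ) * Complex.I) + η (θ - (Real.pi / 2 : ℝ) * Complex.I)
          = g θ) := by
  obtain ⟨C, hC⟩ := hbd
  have hπ := Real.pi_pos
  set r : ℝ := δ / (Real.pi / 2 + δ)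
  have hr : 0 < r := by positivity
  have hr' : r * (Real.pi / 2 + δ) = δ := by
    simp only [r]
    field_simp
  have hr1 : 0 < 1 - r := by nlinarith
  have hline : ∀ y : ℝ, |y| < Real.pi / 2 + δ → |r * y| < δ ∧ |r * y - y| < Real.pi / 2 := by
    intro y hy
    have h : r * y - y = -((1 - r) * y) := by ring
    rw [h, abs_neg, abs_mul, abs_mul, abs_of_pos hr, abs_of_pos hr1]
    constructor <;> nlinarith
  refine ⟨fun θ ↦ sechTransform g (r * θ.im) θ, fun θ hθ ↦ ?_, fun x ↦ ?_, fun θ hθ ↦ ?_⟩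
  · obtain ⟨h1, h2⟩ := hline _ hθ
    refine ((differentiableAt_sechTransform hg hC h1 h2).congr_of_eventuallyEq
      ?_).differentiableWithinAt
    have hU : IsOpen {w : ℂ | |w.im| < Real.pi / 2 + δ ∧ |r * θ.im - w.im| < Real.pi / 2} :=
      by refine IsOpen.and (isOpen_lt ?_ ?_) (isOpen_lt ?_ ?_) <;> fun_prop
    filter_upwards [hU.mem_nhds ⟨hθ, h2⟩] with w hw
    obtain ⟨h3, h4⟩ := hline _ hw.1
    exact sechTransform_eq hg hC h3 h1 h4 hw.2
  · simp [sechTransform]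
  · have h := abs_lt.1 hθ
    obtain ⟨h1, h2⟩ := hline (θ.im + Real.pi / 2) (abs_lt.2 ⟨by linarith, by linarith⟩)
    obtain ⟨h3, h4⟩ := hline (θ.im - Real.pi / 2) (abs_lt.2 ⟨by linarith, by linarith⟩)
    simpa using sechTransform_add_sechTransform hg hC hθ h1 h3 h2 h4
end
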